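/- Let X be a Banach space, β ∈ ℝ, p : ℝ → X a polynomial, and g ∈ C([0,∞), X) with ‖g(t)‖ ≤ M e^{-δt} for some M, δ > 0. Suppose y ∈ C([0,∞), X) solves y'(t) + βy(t) = p(t) + g(t) for t > 0, and in case β < 0 assume additionally that e^{βt}‖y(t)‖ → 0 as t → ∞. Then there exists a unique X-valued polynomial q with q'(t) + βq(t) = p(t) for all t ∈ ℝ, and ‖y(t) − q(t)‖ = O(e^{-εt}) for every ε ∈ (0, ε_{δ,β}), where ε_{δ,β} = min{δ, β} if β > 0 and ε_{δ,β} = δ otherwise. -/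

import Mathlib

/-- An `X`-valued polynomial function of one real variable. -/
def IsPolyFun {X : Type*} [AddCommGroup X] [Module ℝ X] (q : ℝ → X) : Prop :=
  ∃ (N : ℕ) (a : ℕ → X), ∀ t : ℝ, q t = ∑ k ∈ Finset.range (N + 1), t ^ k • a k

open Filter Topology

section Aux
variable {X : Type*} [NormedAddCommGroup X] [NormedSpace ℝ X]

lemma IsPolyFun.pad {q : ℝ → X} (h : IsPolyFun q) :
    ∃ (N : ℕ) (a : ℕ → X), ∀ n ≥ N, ∀ t : ℝ, q t = ∑ k ∈ Finset.range (n + 1), t ^ k • a k := by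
  obtain ⟨N, a, ha⟩ := h
  refine ⟨N, fun k => if k < N + 1 then a k else 0, fun n hn t => ?_⟩
  rw [ha t]
  have hsub : Finset.range (N + 1) ⊆ Finset.range (n + 1) := by
    intro k hk
    simp only [Finset.mem_range] at *
    omega
  rw [← Finset.sum_subset hsub]
  · refine Finset.sum_congr rfl fun k hk => ?_
    simp only [if_pos (Finset.mem_range.1 hk)]
  · intro k _ hk
    have hk' : ¬ k < N + 1 := fun h => hk (Finset.mem_range.2 h)
    simp only [if_neg hk', smul_zero]

lemma IsPolyFun.add' {q r : ℝ → X} (hq : IsPolyFun q) (hr : IsPolyFun r) :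
    IsPolyFun (fun t => q t + r t) := by
  obtain ⟨N, a, ha⟩ := hq.pad
  obtain ⟨K, b, hb⟩ := hr.pad
  refine ⟨N + K, fun k => a k + b k, fun t => ?_⟩
  show q t + r t = _
  rw [ha (N + K) (by omega) t, hb (N + K) (by omega) t, ← Finset.sum_add_distrib]
  simp only [smul_add]

lemma IsPolyFun.smul' {q : ℝ → X} (hq : IsPolyFun q) (c : ℝ) :
    IsPolyFun (fun t => c • q t) := by
  obtain ⟨N, a, ha⟩ := hq
  refine ⟨N, fun k => c • a k, fun t => ?_⟩
  show c • q t = _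
  rw [ha t, Finset.smul_sum]
  exact Finset.sum_congr rfl fun k _ => smul_comm _ _ _

lemma isPolyFun_monomial (k : ℕ) (a : X) : IsPolyFun (fun t : ℝ => t ^ k • a) := by
  refine ⟨k, fun j => if j = k then a else 0, fun t => ?_⟩
  simp

lemma isPolyFun_const (a : X) : IsPolyFun (fun _ : ℝ => a) := by
  simpa using isPolyFun_monomial 0 a

lemma hasDerivAt_monomial (k : ℕ) (a : X) (t : ℝ) :
    HasDerivAt (fun t : ℝ => t ^ k • a) (((k : ℝ) * t ^ (k - 1)) • a) t :=
  (hasDerivAt_pow k t).smul_const a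

lemma solve_monomial (β : ℝ) (k : ℕ) (a : X) :
    ∃ q : ℝ → X, IsPolyFun q ∧ ∀ t : ℝ, HasDerivAt q (t ^ k • a - β • q t) t := by
  by_cases hβ : β = 0
  · refine ⟨_, isPolyFun_monomial (k + 1) (((k : ℝ) + 1)⁻¹ • a), fun t => ?_⟩
    refine (hasDerivAt_monomial (k + 1) (((k : ℝ) + 1)⁻¹ • a) t).congr_deriv ?_
    have : (k : ℝ) + 1 ≠ 0 := by positivity
    rw [hβ, zero_smul, sub_zero, smul_smul]
    congr 1
    push_cast
    field_simp
  · induction k with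
    | zero =>
      refine ⟨_, isPolyFun_const (β⁻¹ • a), fun t => ?_⟩
      refine (hasDerivAt_const t _).congr_deriv ?_
      simp [smul_smul, hβ]
    | succ k ih =>
      obtain ⟨q, hq, hd⟩ := ih
      refine ⟨_, ((isPolyFun_monomial (k + 1) a).add' (hq.smul' (-((k : ℝ) + 1)))).smul' β⁻¹,
        fun t => ?_⟩
      refine (((hasDerivAt_monomial (k + 1) a t).add
        ((hd t).const_smul (-((k : ℝ) + 1)))).const_smul β⁻¹).congr_deriv ?_
      simp only [Nat.add_sub_cancel]
      push_cast
      match_scalars <;> field_simp <;> ring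

lemma solve_poly (β : ℝ) {p : ℝ → X} (hp : IsPolyFun p) :
    ∃ q : ℝ → X, IsPolyFun q ∧ ∀ t : ℝ, HasDerivAt q (p t - β • q t) t := by
  obtain ⟨N, a, ha⟩ := hp
  obtain rfl : p = fun t => ∑ k ∈ Finset.range (N + 1), t ^ k • a k := funext ha
  clear ha
  generalize N + 1 = n
  induction n with
  | zero => exact ⟨_, isPolyFun_const 0, fun t => by simpa using hasDerivAt_const t (0 : X)⟩
  | succ n ih =>
    obtain ⟨q, hq, hd⟩ := ih
    obtain ⟨r, hr, hd'⟩ := solve_monomial β n (a n)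
    refine ⟨_, hq.add' hr, fun t => ((hd t).add (hd' t)).congr_deriv ?_⟩
    simp only [Finset.sum_range_succ, smul_add]
    abel

lemma IsPolyFun.eq_zero_of_tendsto {r : ℝ → X} (hr : IsPolyFun r)
    (h : Tendsto r atTop (𝓝 0)) (t : ℝ) : r t = 0 := by
  obtain ⟨N, a, ha⟩ := hr
  refine (SeparatingDual.eq_zero_iff_forall_dual_eq_zero (R := ℝ) (r t)).2 fun f => ?_
  let P : Polynomial ℝ := ∑ k ∈ Finset.range (N + 1), Polynomial.monomial k (f (a k))
  have hP : ∀ s, P.eval s = f (r s) := by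
    intro s
    simp only [P, ha s, Polynomial.eval_finsetSum, Polynomial.eval_monomial, map_sum, map_smul,
      smul_eq_mul]
    exact Finset.sum_congr rfl fun k _ => mul_comm _ _
  have ht : Tendsto (fun s => P.eval s) atTop (𝓝 0) := by
    simp only [hP]
    have h1 := (f.continuous.tendsto 0).comp h
    rw [map_zero] at h1
    exact h1
  have := (P.tendsto_nhds_iff.1 ht)
  have hP0 : P = 0 := Polynomial.leadingCoeff_eq_zero.1 this.1
  rw [← hP, hP0, Polynomial.eval_zero]

lemma IsPolyFun.exp_tendsto {q : ℝ → X} (hq : IsPolyFun q) {β : ℝ} (hβ : β < 0) :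
    Tendsto (fun t => Real.exp (β * t) • q t) atTop (𝓝 0) := by
  obtain ⟨N, a, ha⟩ := hq
  have : ∀ k ∈ Finset.range (N + 1),
      Tendsto (fun t : ℝ => (Real.exp (β * t) * t ^ k) • a k) atTop (𝓝 0) := by
    intro k _
    have h1 : Tendsto (fun t : ℝ => t ^ k * Real.exp (- -β * t)) atTop (𝓝 0) := by
      have := tendsto_rpow_mul_exp_neg_mul_atTop_nhds_zero k (-β) (by linarith)
      simpa only [Real.rpow_natCast] using this
    have h2 := h1.smul_const (a k)
    rw [zero_smul] at h2
    refine h2.congr fun t => ?_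
    rw [neg_neg, mul_comm]
  have h := tendsto_finsetSum _ this
  rw [Finset.sum_const_zero] at h
  refine h.congr fun t => ?_
  rw [ha t, Finset.smul_sum]
  exact Finset.sum_congr rfl fun k _ => (smul_smul _ _ _).symm

lemma exp_bound {f f' : ℝ → X} {M c : ℝ} (hc : c ≠ 0)
    (hf : ∀ t > (0:ℝ), HasDerivAt f (f' t) t)
    (hb : ∀ t > (0:ℝ), ‖f' t‖ ≤ M * Real.exp (c * t)) {s t : ℝ} (hs : 1 ≤ s) (hst : s ≤ t) :
    ‖f t - f s‖ ≤ M / c * (Real.exp (c * t) - Real.exp (c * s)) := by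
  have hB : ∀ x : ℝ, HasDerivAt (fun x => M / c * (Real.exp (c * x) - Real.exp (c * s)))
      (M * Real.exp (c * x)) x := by
    intro x
    have h1 : HasDerivAt (fun x : ℝ => c * x) c x := by
      simpa using (hasDerivAt_id x).const_mul c
    refine ((h1.exp.sub_const (Real.exp (c * s))).const_mul (M / c)).congr_deriv ?_
    field_simp
  refine image_norm_le_of_norm_deriv_right_le_deriv_boundary
    (f := fun x => f x - f s) (f' := f') (a := s) (b := t) ?_ ?_ ?_ hB ?_ ⟨hst, le_rfl⟩
  · intro x hx
    exact ((hf x (by linarith [hx.1])).continuousAt.sub continuousAt_const).continuousWithinAt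
  · intro x hx
    exact ((hf x (by linarith [hx.1])).sub_const _).hasDerivWithinAt
  · simp
  · intro x hx
    exact hb x (by linarith [hx.1])

lemma exp_bound_neg {f f' : ℝ → X} {M c : ℝ} (hM : 0 < M) (hc : c < 0)
    (hf : ∀ t > (0:ℝ), HasDerivAt f (f' t) t)
    (hb : ∀ t > (0:ℝ), ‖f' t‖ ≤ M * Real.exp (c * t)) {s t : ℝ} (hs : 1 ≤ s) (hst : s ≤ t) :
    ‖f t - f s‖ ≤ M / (-c) * Real.exp (c * s) := by
  refine (exp_bound hc.ne hf hb hs hst).trans ?_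
  have h1 : 0 < M / (-c) := div_pos hM (by linarith)
  have h2 : M / c = -(M / (-c)) := by rw [div_neg, neg_neg]
  rw [h2]
  nlinarith [Real.exp_pos (c * t)]

lemma exp_bound_lim {f f' : ℝ → X} {M c : ℝ} (hM : 0 < M) (hc : c < 0)
    (hf : ∀ t > (0:ℝ), HasDerivAt f (f' t) t)
    (hb : ∀ t > (0:ℝ), ‖f' t‖ ≤ M * Real.exp (c * t)) {L : X} (hL : Tendsto f atTop (𝓝 L))
    {s : ℝ} (hs : 1 ≤ s) :
    ‖f s - L‖ ≤ M / (-c) * Real.exp (c * s) := by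
  rw [norm_sub_rev]
  refine le_of_tendsto (hL.sub_const (f s)).norm ?_
  filter_upwards [eventually_ge_atTop s] with t ht
  exact exp_bound_neg hM hc hf hb hs ht

lemma tendsto_exp_neg {c : ℝ} (hc : c < 0) :
    Tendsto (fun t : ℝ => Real.exp (c * t)) atTop (𝓝 0) :=
  Real.tendsto_exp_atBot.comp (tendsto_id.const_mul_atTop_of_neg hc)

lemma exists_lim [CompleteSpace X] {f f' : ℝ → X} {M c : ℝ} (hM : 0 < M) (hc : c < 0)
    (hf : ∀ t > (0:ℝ), HasDerivAt f (f' t) t)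
    (hb : ∀ t > (0:ℝ), ‖f' t‖ ≤ M * Real.exp (c * t)) : ∃ L, Tendsto f atTop (𝓝 L) := by
  apply cauchySeq_tendsto_of_complete
  have h0 : Tendsto (fun s : ℝ => M / (-c) * Real.exp (c * s)) atTop (𝓝 0) := by
    simpa using (tendsto_exp_neg hc).const_mul (M / (-c))
  rw [Metric.cauchySeq_iff']
  intro ε hε
  obtain ⟨s, hs1, hs⟩ := ((h0.eventually (gt_mem_nhds hε)).and (eventually_ge_atTop 1)).exists
  refine ⟨s, fun t ht => ?_⟩
  rw [dist_eq_norm]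
  exact (exp_bound_neg hM hc hf hb hs ht).trans_lt hs1

end Aux

/-- Lemma 2.1: approximation lemma for the scalar linear ODE
`y' + β y = p + g` in a Banach space, with exponentially decaying `g`. -/
theorem stmt6 {X : Type*} [NormedAddCommGroup X] [NormedSpace ℝ X] [CompleteSpace X]
    (β : ℝ) (p : ℝ → X) (hp : IsPolyFun p)
    (g : ℝ → X) (hgcont : ContinuousOn g (Set.Ici 0))
    (M δ : ℝ) (hM : 0 < M) (hδ : 0 < δ)
    (hg : ∀ t ≥ (0:ℝ), ‖g t‖ ≤ M * Real.exp (-δ * t))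
    (y : ℝ → X) (hycont : ContinuousOn y (Set.Ici 0))
    (hode : ∀ t > (0:ℝ), HasDerivAt y (p t + g t - β • y t) t)
    (hneg : β < 0 →
      Filter.Tendsto (fun t => Real.exp (β * t) * ‖y t‖) Filter.atTop (nhds 0)) :
    ∃! q : ℝ → X, IsPolyFun q ∧
      (∀ t : ℝ, HasDerivAt q (p t - β • q t) t) ∧
      ∀ ε ∈ Set.Ioo 0 (if 0 < β then min δ β else δ),
        ∃ T C : ℝ, 0 < C ∧ ∀ t ≥ T, ‖y t - q t‖ ≤ C * Real.exp (-ε * t) := by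
  set E : ℝ := if 0 < β then min δ β else δ with hE
  have hE0 : 0 < E := by
    rw [hE]; split_ifs with h
    · exact lt_min hδ h
    · exact hδ
  have hEδ : E ≤ δ := by
    rw [hE]; split_ifs with h
    · exact min_le_left _ _
    · exact le_rfl
  suffices hex : ∃ q : ℝ → X, IsPolyFun q ∧
      (∀ t : ℝ, HasDerivAt q (p t - β • q t) t) ∧
      ∀ ε ∈ Set.Ioo 0 E,
        ∃ T C : ℝ, 0 < C ∧ ∀ t ≥ T, ‖y t - q t‖ ≤ C * Real.exp (-ε * t) by
    obtain ⟨q, hq, hd, hO⟩ := hex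
    refine ⟨q, ⟨hq, hd, hO⟩, ?_⟩
    rintro r ⟨hr, -, hO'⟩
    have key : ∀ u : ℝ → X, (∀ ε ∈ Set.Ioo 0 E,
        ∃ T C : ℝ, 0 < C ∧ ∀ t ≥ T, ‖y t - u t‖ ≤ C * Real.exp (-ε * t)) →
        Tendsto (fun t => y t - u t) atTop (𝓝 0) := by
      intro u hu
      obtain ⟨T, C, hC, h⟩ := hu (E / 2) ⟨by linarith, by linarith⟩
      have h0 : Tendsto (fun s : ℝ => C * Real.exp (-(E / 2) * s)) atTop (𝓝 0) := by
        simpa using (tendsto_exp_neg (c := -(E / 2)) (by linarith)).const_mul C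
      refine squeeze_zero_norm' ?_ h0
      filter_upwards [eventually_ge_atTop T] with t ht using h t ht
    have hz := (key q hO).sub (key r hO')
    rw [sub_zero] at hz
    funext t
    have := (hr.add' (hq.smul' (-1))).eq_zero_of_tendsto (hz.congr fun t => by
      rw [neg_one_smul]; abel) t
    rw [neg_one_smul, ← sub_eq_add_neg] at this
    exact sub_eq_zero.1 this
  obtain ⟨q, hq, hd⟩ := solve_poly β hp
  -- the rescaled difference
  have hh : ∀ t > (0:ℝ), HasDerivAt (fun t => Real.exp (β * t) • (y t - q t))
      (Real.exp (β * t) • g t) t := by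
    intro t ht
    have h1 : HasDerivAt (fun x : ℝ => β * x) β t := by
      simpa using (hasDerivAt_id t).const_mul β
    refine (h1.exp.smul ((hode t ht).sub (hd t))).congr_deriv ?_
    simp only [Pi.sub_apply]
    module
  have hb : ∀ t > (0:ℝ), ‖Real.exp (β * t) • g t‖ ≤ M * Real.exp ((β - δ) * t) := by
    intro t ht
    rw [norm_smul, Real.norm_eq_abs, Real.abs_exp]
    calc Real.exp (β * t) * ‖g t‖ ≤ Real.exp (β * t) * (M * Real.exp (-δ * t)) := by
          gcongr; exact hg t ht.le
      _ = M * (Real.exp (β * t) * Real.exp (-δ * t)) := by ring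
      _ = _ := by rw [← Real.exp_add]; ring_nf
  have hz : ∀ t, ‖y t - q t‖ = Real.exp (-β * t) * ‖Real.exp (β * t) • (y t - q t)‖ := by
    intro t
    rw [norm_smul, Real.norm_eq_abs, Real.abs_exp, ← mul_assoc, ← Real.exp_add]
    simp
  -- conversion for nonpositive exponent
  have hδε : ∀ {ε t : ℝ}, ε ∈ Set.Ioo 0 E → 1 ≤ t → Real.exp (-δ * t) ≤ Real.exp (-ε * t) := by
    intro ε t hε ht
    apply Real.exp_le_exp.2
    nlinarith [hε.2]
  rcases lt_trichotomy β 0 with hβ | hβ | hβ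
  · refine ⟨q, hq, hd, fun ε hε => ⟨1, M / (-(β - δ)), div_pos hM (by linarith), fun t ht => ?_⟩⟩
    have hL : Tendsto (fun t => Real.exp (β * t) • (y t - q t)) atTop (𝓝 0) := by
      have h1 : Tendsto (fun t => Real.exp (β * t) • y t) atTop (𝓝 0) := by
        rw [tendsto_zero_iff_norm_tendsto_zero]
        refine (hneg hβ).congr fun t => ?_
        rw [norm_smul, Real.norm_eq_abs, Real.abs_exp]
      have h2 := h1.sub (hq.exp_tendsto hβ)
      rw [sub_zero] at h2
      exact h2.congr fun t => (smul_sub _ _ _).symm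
    have h := exp_bound_lim hM (by linarith) hh hb hL ht
    rw [sub_zero] at h
    have hK : 0 < M / (-(β - δ)) := div_pos hM (by linarith)
    calc ‖y t - q t‖ ≤ Real.exp (-β * t) * (M / (-(β - δ)) * Real.exp ((β - δ) * t)) := by
          rw [hz]; gcongr
      _ = M / (-(β - δ)) * (Real.exp (-β * t) * Real.exp ((β - δ) * t)) := by ring
      _ = M / (-(β - δ)) * Real.exp (-δ * t) := by rw [← Real.exp_add]; ring_nf
      _ ≤ _ := mul_le_mul_of_nonneg_left (hδε hε ht) hK.le
  · subst hβ
    simp only [zero_mul, Real.exp_zero, one_smul, zero_sub] at hh hb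
    obtain ⟨L, hL⟩ := exists_lim hM (by linarith) hh hb
    refine ⟨_, hq.add' (isPolyFun_const L), fun t => ((hd t).add_const L).congr_deriv (by simp),
      fun ε hε => ⟨1, M / (- -δ), div_pos hM (by linarith), fun t ht => ?_⟩⟩
    have h := exp_bound_lim hM (by linarith) hh hb hL ht
    rw [← sub_sub]
    exact h.trans (mul_le_mul_of_nonneg_left (hδε hε ht) (div_pos hM (by linarith)).le)
  · refine ⟨q, hq, hd, fun ε hε => ?_⟩
    have hEβ : E ≤ β := by rw [hE, if_pos hβ]; exact min_le_right _ _
    have hεβ : 0 < β - ε := by linarith [hε.2]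
    have hK : 0 < M / (β - ε) := div_pos hM hεβ
    set A := ‖Real.exp (β * 1) • (y 1 - q 1)‖ with hA
    have hA0 : 0 ≤ A := norm_nonneg _
    refine ⟨1, A + M / (β - ε), by linarith, fun t ht => ?_⟩
    have hb' : ∀ t > (0:ℝ), ‖Real.exp (β * t) • g t‖ ≤ M * Real.exp ((β - ε) * t) := by
      intro t ht
      refine (hb t ht).trans (mul_le_mul_of_nonneg_left (Real.exp_le_exp.2 ?_) hM.le)
      nlinarith [hε.2]
    have h := exp_bound hεβ.ne' hh hb' le_rfl ht
    have h1 : 1 ≤ Real.exp ((β - ε) * t) := Real.one_le_exp (by nlinarith)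
    have h2 : ‖Real.exp (β * t) • (y t - q t)‖
        ≤ (A + M / (β - ε)) * Real.exp ((β - ε) * t) := by
      have h3 := norm_le_norm_add_norm_sub' (Real.exp (β * t) • (y t - q t))
        (Real.exp (β * 1) • (y 1 - q 1))
      rw [← hA] at h3
      have h4 := Real.exp_pos ((β - ε) * 1)
      have h5 : 0 < M / (β - ε) * Real.exp ((β - ε) * 1) := mul_pos hK h4
      nlinarith
    calc ‖y t - q t‖ ≤ Real.exp (-β * t) * ((A + M / (β - ε)) * Real.exp ((β - ε) * t)) := by
          rw [hz]; gcongr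
      _ = (A + M / (β - ε)) * (Real.exp (-β * t) * Real.exp ((β - ε) * t)) := by ring
      _ = (A + M / (β - ε)) * Real.exp (-ε * t) := by rw [← Real.exp_add]; ring_nf
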